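/- arXiv:1505.05428 — 4 statements merged into one kernel-verified Lean document; each statement's English description precedes it below -/
import Mathlib

section
/- Fix a real number γ > 0 and define w : R_q → ℝ by w(0) = 0, w(u_1 u_2 ⋯ u_q) = 2γ, and w(x) = γ for every other x ∈ R_q. Then w is a homogeneous weight on R_q with average value γ; that is: (i) for all x, y ∈ R_q, if the principal ideals R_q·x and R_q·y are equal then w(x) = w(y); (ii) for every nonzero x ∈ R_q, Σ_{y ∈ R_q·x} w(y) = γ·|R_q·x|. -/
/-- The ideal of `F₂[u₁,…,u_q]` generated by the squares of all the variables. -/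
noncomputable def sqIdeal (q : ℕ) : Ideal (MvPolynomial (Fin q) (ZMod 2)) :=
  Ideal.span (Set.range fun i : Fin q => MvPolynomial.X i ^ 2)

/-- The ring `R_q = F₂[u₁,…,u_q]/⟨u₁²,…,u_q²⟩`. -/
abbrev Rq (q : ℕ) := MvPolynomial (Fin q) (ZMod 2) ⧸ sqIdeal q

/-- The monomial `u_A = ∏_{i ∈ A} u_i ∈ R_q`. -/
noncomputable def uA (q : ℕ) (A : Finset (Fin q)) : Rq q :=
  ∏ i ∈ A, Ideal.Quotient.mk (sqIdeal q) (MvPolynomial.X i)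

/-- The top monomial `u₁u₂⋯u_q ∈ R_q`. -/
noncomputable def uTop (q : ℕ) : Rq q := uA q Finset.univ

open Classical

/-- The homogeneous weight on `R_q`: `w(0) = 0`, `w(u₁u₂⋯u_q) = 2γ`, `w(x) = γ` otherwise. -/
noncomputable def homWeight (q : ℕ) (γ : ℝ) (x : Rq q) : ℝ :=
  if x = 0 then 0 else if x = uTop q then 2 * γ else γ

/-- The exponent vector `(1,…,1)`. -/
noncomputable def oneExp (q : ℕ) : Fin q →₀ ℕ := Finsupp.equivFunOnFinite.symm fun _ => 1

lemma oneExp_apply (q : ℕ) (i : Fin q) : oneExp q i = 1 := rfl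

lemma uTop_eq (q : ℕ) : uTop q =
    Ideal.Quotient.mk (sqIdeal q) (MvPolynomial.monomial (oneExp q) 1) := by
  unfold uTop uA
  rw [← map_prod, MvPolynomial.monomial_eq, Finsupp.prod_fintype _ _ (by simp)]
  simp [oneExp_apply]

lemma mem_sqIdeal (q : ℕ) (p : MvPolynomial (Fin q) (ZMod 2)) :
    p ∈ sqIdeal q ↔ ∀ n, n ≤ oneExp q → p.coeff n = 0 := by
  have h : sqIdeal q = Ideal.span ((fun s => MvPolynomial.monomial s (1 : ZMod 2)) ''
      (Set.range fun i : Fin q => Finsupp.single i 2)) := by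
    unfold sqIdeal
    rw [← Set.range_comp]
    congr 2
    funext i
    simp [MvPolynomial.X_pow_eq_monomial]
  rw [h, MvPolynomial.mem_ideal_span_monomial_image]
  constructor
  · intro H n hn
    by_contra hne
    obtain ⟨_, ⟨i, rfl⟩, hi⟩ := H n (MvPolynomial.mem_support_iff.2 hne)
    have h1 := hi i
    have h2 := hn i
    simp only [Finsupp.single_eq_same, oneExp_apply] at h1 h2
    omega
  · intro H n hn
    by_contra hne
    push Not at hne
    refine MvPolynomial.mem_support_iff.1 hn (H n fun i => ?_)
    have h1 := hne _ ⟨i, rfl⟩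
    rw [Finsupp.single_le_iff] at h1
    rw [oneExp_apply]
    omega

lemma uTop_ne_zero (q : ℕ) : uTop q ≠ 0 := by
  rw [uTop_eq, Ne, Ideal.Quotient.eq_zero_iff_mem, mem_sqIdeal]
  intro h
  simpa using h _ le_rfl

lemma uTop_mem (q : ℕ) (x : Rq q) (hx : x ≠ 0) : uTop q ∈ Ideal.span {x} := by
  obtain ⟨p, rfl⟩ := Ideal.Quotient.mk_surjective x
  rw [Ne, Ideal.Quotient.eq_zero_iff_mem, mem_sqIdeal] at hx
  push Not at hx
  obtain ⟨m, ⟨hm1, hm2⟩, hmin⟩ := WellFounded.has_min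
    (wellFounded_lt : WellFounded ((· < ·) : (Fin q →₀ ℕ) → (Fin q →₀ ℕ) → Prop))
    {n | n ≤ oneExp q ∧ p.coeff n ≠ 0} hx
  rw [Ideal.mem_span_singleton']
  refine ⟨Ideal.Quotient.mk _ (MvPolynomial.monomial (oneExp q - m) 1), ?_⟩
  rw [uTop_eq, ← map_mul, Ideal.Quotient.eq, mem_sqIdeal]
  intro n hn
  rw [MvPolynomial.coeff_sub, MvPolynomial.coeff_monomial_mul', MvPolynomial.coeff_monomial]
  have hsub : oneExp q - m + m = oneExp q := tsub_add_cancel_of_le hm1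
  have hc : p.coeff m = 1 := by
    have : ∀ a : ZMod 2, a ≠ 0 → a = 1 := by decide
    exact this _ hm2
  by_cases h1 : oneExp q = n
  · subst h1
    have : oneExp q - (oneExp q - m) = m := tsub_tsub_cancel_of_le hm1
    simp [this, hc]
  · rw [if_neg h1, sub_zero]
    split_ifs with h2
    · rw [one_mul]
      by_contra h3
      have hle : n - (oneExp q - m) ≤ m := by
        rw [tsub_le_iff_left, hsub]; exact hn
      have hne : n - (oneExp q - m) ≠ m := by
        intro h
        apply h1
        rw [← hsub, ← tsub_add_cancel_of_le h2, h, add_comm]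
      exact hmin _ ⟨hle.trans hm1, h3⟩ (lt_of_le_of_ne hle hne)
    · rfl

lemma mul_uTop (q : ℕ) (r : Rq q) : r * uTop q = 0 ∨ r * uTop q = uTop q := by
  obtain ⟨p, rfl⟩ := Ideal.Quotient.mk_surjective r
  have key : ∀ c : ZMod 2, c = p.coeff 0 → Ideal.Quotient.mk (sqIdeal q) p * uTop q =
      Ideal.Quotient.mk (sqIdeal q) (MvPolynomial.monomial (oneExp q) c) := by
    intro c hc
    rw [uTop_eq, ← map_mul, Ideal.Quotient.eq, mem_sqIdeal]
    intro n hn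
    rw [MvPolynomial.coeff_sub, MvPolynomial.coeff_mul_monomial', MvPolynomial.coeff_monomial]
    by_cases h : oneExp q = n
    · subst h
      simp [hc]
    · rw [if_neg h, if_neg (fun h' => h (le_antisymm h' hn)), sub_zero]
  have h2 : ∀ a : ZMod 2, a = 0 ∨ a = 1 := by decide
  rcases h2 (p.coeff 0) with h | h
  · left; rw [key 0 h.symm]; simp
  · right; rw [key 1 h.symm, uTop_eq]

/-- Fix `γ > 0` and define `w : R_q → ℝ` by `w(0) = 0`, `w(u₁u₂⋯u_q) = 2γ` and
`w(x) = γ` otherwise. Then `w` is a homogeneous weight on `R_q` with average value `γ`: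
(i) if the principal ideals `R_q·x` and `R_q·y` are equal then `w(x) = w(y)`;
(ii) for every nonzero `x`, `Σ_{y ∈ R_q·x} w(y) = γ·|R_q·x|`. -/
theorem homWeight_is_homogeneous (q : ℕ) (hq : 1 ≤ q) [Finite (Rq q)] (γ : ℝ) (hγ : 0 < γ) :
    (∀ x y : Rq q, Ideal.span {x} = Ideal.span {y} → homWeight q γ x = homWeight q γ y) ∧
    (∀ x : Rq q, x ≠ 0 →
      ∑ᶠ y ∈ ((Ideal.span {x} : Ideal (Rq q)) : Set (Rq q)), homWeight q γ y =
        γ * (Nat.card (Ideal.span {x} : Ideal (Rq q)) : ℝ)) := by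
  constructor
  · have aux : ∀ x y : Rq q, Ideal.span {x} = Ideal.span {y} → x = 0 → y = 0 := by
      intro x y h hx
      subst hx
      rw [← Ideal.span_singleton_eq_bot, ← h]
      simp
    have aux2 : ∀ x y : Rq q, Ideal.span {x} = Ideal.span {y} → x = uTop q → y = uTop q := by
      intro x y h hx
      subst hx
      have hy : y ∈ Ideal.span {uTop q} := h ▸ Ideal.mem_span_singleton_self y
      obtain ⟨r, hr⟩ := Ideal.mem_span_singleton'.1 hy
      rcases mul_uTop q r with h0 | h0
      · exact absurd (aux _ _ h.symm (hr.symm.trans h0)) (uTop_ne_zero q)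
      · exact hr.symm.trans h0
    intro x y h
    unfold homWeight
    have e1 : x = 0 ↔ y = 0 := ⟨aux x y h, aux y x h.symm⟩
    have e2 : x = uTop q ↔ y = uTop q := ⟨aux2 x y h, aux2 y x h.symm⟩
    simp only [e1, e2]
  · intro x hx
    have : Fintype (Rq q) := Fintype.ofFinite _
    have hw : ∀ y : Rq q, homWeight q γ y =
        γ + (if y = uTop q then γ else 0) - (if y = 0 then γ else 0) := by
      intro y
      unfold homWeight
      by_cases h0 : y = 0
      · subst h0
        simp [(uTop_ne_zero q).symm]
      · by_cases h1 : y = uTop q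
        · simp [h1, uTop_ne_zero q]; ring
        · simp [h0, h1]
    have hc : Nat.card (Ideal.span {x} : Ideal (Rq q)) =
        ((Ideal.span {x} : Ideal (Rq q)) : Set (Rq q)).toFinset.card := by
      rw [Set.toFinset_card, Nat.card_eq_fintype_card]; rfl
    rw [hc, finsum_mem_eq_toFinset_sum]
    simp only [hw]
    rw [Finset.sum_sub_distrib, Finset.sum_add_distrib, Finset.sum_ite_eq', Finset.sum_ite_eq',
      if_pos (by simpa using uTop_mem q x hx), if_pos (by simp)]
    simp [mul_comm]
end

section
/- For every nonzero ideal I of R_q, the sum of the Lee weights of the elements of I equals 2^(q−1)·|I|, i.e. Σ_{t ∈ I} w_Lee(t) = 2^(q−1)·|I|. -/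
lemma uA_mul_of_mem (q : ℕ) (A B : Finset (Fin q)) (i : Fin q) (hA : i ∈ A) (hB : i ∈ B) :
    uA q A * uA q B = 0 := by
  have h : (Ideal.Quotient.mk (sqIdeal q) (MvPolynomial.X i)) *
      (Ideal.Quotient.mk (sqIdeal q) (MvPolynomial.X i)) = 0 := by
    rw [← map_mul, Ideal.Quotient.eq_zero_iff_mem, ← pow_two]
    exact Ideal.subset_span ⟨i, rfl⟩
  unfold uA
  rw [← Finset.mul_prod_erase A _ hA, ← Finset.mul_prod_erase B _ hB, mul_mul_mul_comm, h,
    zero_mul]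

lemma uA_span (q : ℕ) : Submodule.span (ZMod 2) (Set.range (uA q)) = ⊤ := by
  rw [eq_top_iff]
  rintro x -
  obtain ⟨p, rfl⟩ := Ideal.Quotient.mk_surjective x
  induction p using MvPolynomial.induction_on with
  | C a =>
    have : Ideal.Quotient.mk (sqIdeal q) (MvPolynomial.C a) = a • uA q ∅ := by
      rw [MvPolynomial.C_eq_smul_one]
      simp only [uA, Finset.prod_empty]
      rfl
    rw [this]
    exact Submodule.smul_mem _ _ (Submodule.subset_span ⟨_, rfl⟩)
  | add p r hp hr =>
    rw [map_add]
    exact Submodule.add_mem _ hp hr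
  | mul_X p i hp =>
    rw [map_mul]
    generalize Ideal.Quotient.mk (sqIdeal q) p = y at hp
    have hi : Ideal.Quotient.mk (sqIdeal q) (MvPolynomial.X i) = uA q {i} := by simp [uA]
    rw [hi]
    induction hp using Submodule.span_induction with
    | mem y hy =>
      obtain ⟨A, rfl⟩ := hy
      by_cases h : i ∈ A
      · rw [uA_mul_of_mem q A {i} i h (by simp)]
        exact Submodule.zero_mem _
      · apply Submodule.subset_span
        refine ⟨insert i A, ?_⟩
        simp [uA, Finset.prod_insert h, mul_comm]
    | zero => rw [zero_mul]; exact Submodule.zero_mem _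
    | add a b _ _ ha hb => rw [add_mul]; exact Submodule.add_mem _ ha hb
    | smul c a _ ha => rw [smul_mul_assoc]; exact Submodule.smul_mem _ _ ha

lemma uTop_mem_s11 (q : ℕ) (I : Ideal (Rq q)) (hI : I ≠ ⊥) : uTop q ∈ I := by
  classical
  obtain ⟨x, hx, hx0⟩ := Submodule.exists_mem_ne_zero_of_ne_bot hI
  have hs : x ∈ Submodule.span (ZMod 2) (Set.range (uA q)) := by
    rw [uA_span]; trivial
  obtain ⟨c, rfl⟩ := (Submodule.mem_span_range_iff_exists_fun _).1 hs
  have hne : (Finset.univ.filter fun A => c A ≠ 0).Nonempty := by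
    by_contra h
    apply hx0
    apply Finset.sum_eq_zero
    intro A _
    by_contra hA
    exact h ⟨A, by simpa using fun h0 => hA (by rw [h0, zero_smul])⟩
  obtain ⟨A, hAm, hA⟩ := Finset.exists_min_image _ Finset.card hne
  have hc : c A = 1 := by
    have h0 : c A ≠ 0 := by simpa using hAm
    revert h0
    generalize c A = z
    revert z
    decide
  have key : (∑ B, c B • uA q B) * uA q Aᶜ = uTop q := by
    rw [Finset.sum_mul, Finset.sum_eq_single A]
    · rw [hc, one_smul]
      exact Finset.prod_mul_prod_compl A _
    · intro B _ hBA
      by_cases h0 : c B = 0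
      · rw [h0, zero_smul, zero_mul]
      · have hcard := hA B (by simpa using h0)
        have : ¬ B ⊆ A := fun h => hBA (Finset.eq_of_subset_of_card_le h hcard)
        obtain ⟨i, hiB, hiA⟩ := Finset.not_subset.1 this
        rw [smul_mul_assoc, uA_mul_of_mem q B Aᶜ i hiB (by simpa using hiA), smul_zero]
    · simp
  rw [← key]
  exact I.mul_mem_right _ hx

lemma hamming_flip (q : ℕ) (v : Finset (Fin q) → ZMod 2) :
    hammingNorm v + hammingNorm (v + fun _ => 1) = 2 ^ q := by
  have h : ∀ z : ZMod 2, (z + 1 ≠ 0) ↔ ¬ (z ≠ 0) := by decide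
  simp only [hammingNorm, Pi.add_apply, h]
  rw [Finset.card_filter_add_card_filter_not]
  simp

/-- For every nonzero ideal `I` of `R_q`, the sum of the Lee weights of the
elements of `I` equals `2^(q−1)·|I|`, where the Lee weight of `x` is the Hamming weight of its
image under the Gray map `Ψ` (specified uniquely by `hΨ`). -/
theorem sum_lee_weight_ideal (q : ℕ) (hq : 1 ≤ q) [Finite (Rq q)]
    (Ψ : Rq q →ₗ[ZMod 2] (Finset (Fin q) → ZMod 2))
    (hΨ : ∀ A B : Finset (Fin q), Ψ (uA q A) B = if B ⊆ A then 1 else 0)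
    (I : Ideal (Rq q)) (hI : I ≠ ⊥) :
    ∑ᶠ t ∈ (I : Set (Rq q)), hammingNorm (Ψ t) = 2 ^ (q - 1) * Nat.card I := by
  classical
  haveI : Fintype I := Fintype.ofFinite I
  rw [← finsum_set_coe_eq_finsum_mem, finsum_eq_sum_of_fintype, Nat.card_eq_fintype_card]
  have hT : Ψ (uTop q) = fun _ => 1 := by
    funext B
    simp [uTop, hΨ]
  let T : I := ⟨uTop q, uTop_mem_s11 q I hI⟩
  have h1 : ∑ t : I, hammingNorm (Ψ (t : Rq q)) = ∑ t : I, hammingNorm (Ψ ((t + T : I) : Rq q)) :=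
    (Equiv.sum_comp (Equiv.addRight T) (fun t : I => hammingNorm (Ψ (t : Rq q)))).symm
  have h2 : ∑ t : I, hammingNorm (Ψ (t : Rq q)) + ∑ t : I, hammingNorm (Ψ ((t + T : I) : Rq q))
      = Fintype.card I * 2 ^ q := by
    rw [← Finset.sum_add_distrib, Finset.sum_congr rfl (g := fun _ => 2 ^ q)]
    · simp
    · intro t _
      have : Ψ ((t + T : I) : Rq q) = Ψ (t : Rq q) + fun _ => 1 := by
        rw [← hT, ← map_add]; rfl
      rw [this, hamming_flip]
  obtain ⟨k, rfl⟩ : ∃ k, q = k + 1 := ⟨q - 1, by omega⟩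
  rw [← h1, pow_succ] at h2
  have h3 : ∑ t : I, hammingNorm (Ψ (t : Rq (k+1))) = 2 ^ k * Fintype.card I := by
    linarith
  exact h3
end

section
/- Every codeword c_m of the simplex code S^α_(q,k) for which some entry of m is a unit of R_q has Hamming weight exactly 2^(2^q·k) − 2^(2^q·(k−1)), i.e. exactly 2^(2^q·(k−1)) of its 2^(2^q·k) coordinates are zero. -/
/-- Exponent vectors with entries in `{0,1}`. -/
noncomputable def sqfExp {q : ℕ} (e : Fin q → Fin 2) : Fin q →₀ ℕ :=
  Finsupp.equivFunOnFinite.symm fun i => (e i : ℕ)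

theorem sqfExp_inj {q : ℕ} : Function.Injective (sqfExp (q := q)) := by
  intro a b h
  funext i
  have := DFunLike.congr_fun h i
  exact Fin.ext (by simpa [sqfExp] using this)

/-- The squarefree coefficients of a polynomial. -/
noncomputable def sqfCoeff (q : ℕ) :
    MvPolynomial (Fin q) (ZMod 2) →ₗ[ZMod 2] ((Fin q → Fin 2) → ZMod 2) :=
  LinearMap.pi fun e => MvPolynomial.lcoeff (ZMod 2) (sqfExp e)

theorem sqfCoeff_apply {q : ℕ} (p : MvPolynomial (Fin q) (ZMod 2)) (e : Fin q → Fin 2) :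
    sqfCoeff q p e = MvPolynomial.coeff (sqfExp e) p := rfl

theorem sqfCoeff_surj (q : ℕ) : Function.Surjective (sqfCoeff q) := by
  classical
  intro f
  refine ⟨∑ e, MvPolynomial.monomial (sqfExp e) (f e), ?_⟩
  funext e
  rw [sqfCoeff_apply, MvPolynomial.coeff_sum]
  simp [MvPolynomial.coeff_monomial, sqfExp_inj.eq_iff]

theorem mem_sqIdeal_iff {q : ℕ} (p : MvPolynomial (Fin q) (ZMod 2)) :
    p ∈ sqIdeal q ↔ sqfCoeff q p = 0 := by
  classical
  have h : sqIdeal q = Ideal.span ((fun s => MvPolynomial.monomial s (1 : ZMod 2)) ''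
      (Set.range fun i : Fin q => Finsupp.single i 2)) := by
    rw [sqIdeal, ← Set.range_comp]
    congr 2
    funext i
    simp [MvPolynomial.X_pow_eq_monomial]
  rw [h, MvPolynomial.mem_ideal_span_monomial_image]
  constructor
  · intro H
    funext e
    rw [sqfCoeff_apply]
    by_contra hne
    obtain ⟨_, ⟨i, rfl⟩, hi⟩ := H _ (MvPolynomial.mem_support_iff.2 hne)
    have h2 := hi i
    simp [sqfExp] at h2
    have := (e i).isLt
    omega
  · intro H d hd
    by_contra hno
    have hlt : ∀ i, d i < 2 := by
      intro i
      by_contra hi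
      exact hno ⟨_, ⟨i, rfl⟩, by
        rw [Finsupp.single_le_iff]; omega⟩
    have hde : sqfExp (fun i => (⟨d i, hlt i⟩ : Fin 2)) = d := by
      ext i
      simp [sqfExp]
    have := congrFun H (fun i => (⟨d i, hlt i⟩ : Fin 2))
    rw [sqfCoeff_apply, hde] at this
    exact (MvPolynomial.mem_support_iff.1 hd) this

theorem card_Rq (q : ℕ) : Nat.card (Rq q) = 2 ^ 2 ^ q := by
  have hk : (sqIdeal q).toAddSubgroup = (sqfCoeff q).toAddMonoidHom.ker := by
    ext p
    exact mem_sqIdeal_iff p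
  have e : Rq q ≃ ((Fin q → Fin 2) → ZMod 2) :=
    ((QuotientAddGroup.quotientAddEquivOfEq hk).trans
      (QuotientAddGroup.quotientKerEquivOfSurjective _ (sqfCoeff_surj q))).toEquiv
  rw [Nat.card_congr e]
  simp [Nat.card_eq_fintype_card]

/-- Every codeword `c_m` of the simplex code `S^α_(q,k)` for which some entry of
`m` is a unit of `R_q` has Hamming weight exactly `2^(2^q·k) − 2^(2^q·(k−1))`, i.e. exactly
`2^(2^q·(k−1))` of its `2^(2^q·k)` coordinates are zero. -/
theorem simplex_alpha_hamming_weight (q k : ℕ) (hq : 1 ≤ q) (hk : 1 ≤ k)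
    (m : Fin k → Rq q) (hm : ∃ i, IsUnit (m i)) :
    Nat.card {v : Fin k → Rq q // ∑ i, m i * v i ≠ 0} =
      2 ^ (2 ^ q * k) - 2 ^ (2 ^ q * (k - 1)) ∧
    Nat.card {v : Fin k → Rq q // ∑ i, m i * v i = 0} = 2 ^ (2 ^ q * (k - 1)) := by
  classical
  have hc := card_Rq q
  have : Finite (Rq q) := Nat.finite_of_card_ne_zero (by rw [hc]; positivity)
  let L : (Fin k → Rq q) →+ Rq q :=
    { toFun := fun v => ∑ i, m i * v i
      map_zero' := by simp
      map_add' := by intro a b; simp [mul_add, Finset.sum_add_distrib] }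
  have hL : Function.Surjective L := by
    obtain ⟨i, u, hu⟩ := hm
    intro r
    refine ⟨Pi.single i (↑u⁻¹ * r), ?_⟩
    change ∑ j, m j * (Pi.single i (↑u⁻¹ * r) : Fin k → Rq q) j = r
    rw [Finset.sum_eq_single i]
    · rw [Pi.single_eq_same, ← hu, Units.mul_inv_cancel_left]
    · intro j _ hj
      rw [Pi.single_eq_of_ne hj, mul_zero]
    · simp
  have hV : Nat.card (Fin k → Rq q) = 2 ^ (2 ^ q * k) := by
    rw [Nat.card_fun, hc, Nat.card_fin, pow_mul]
  have hker : Nat.card L.ker * Nat.card (Rq q) = Nat.card (Fin k → Rq q) := by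
    rw [← Nat.card_congr (QuotientAddGroup.quotientKerEquivOfSurjective L hL).toEquiv]
    exact L.ker.card_mul_index
  have h0 : Nat.card {v : Fin k → Rq q // ∑ i, m i * v i = 0} = 2 ^ (2 ^ q * (k - 1)) := by
    change Nat.card L.ker = _
    rw [hc, hV] at hker
    refine Nat.eq_of_mul_eq_mul_right (show 0 < 2 ^ 2 ^ q by positivity) ?_
    rw [hker, ← pow_add]
    congr 1
    obtain ⟨j, rfl⟩ := Nat.exists_eq_add_of_le hk
    simp
    ring
  refine ⟨?_, h0⟩
  have hs := Nat.card_congr (Equiv.sumCompl fun v : Fin k → Rq q => ∑ i, m i * v i = 0)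
  rw [Nat.card_sum, h0, hV] at hs
  exact Nat.eq_sub_of_add_eq' hs
end

section
/- For every nonempty code C ⊆ R_q^n (not necessarily linear), the Lee covering radius of C equals the Hamming covering radius of its Gray image: r_Lee(C) = r_Ham(Ψ_Lee(C)), where Ψ_Lee is applied coordinatewise and r_Ham is computed in the ambient space F_2^(2^q·n). -/
set_option synthInstance.maxHeartbeats 1000000
set_option maxHeartbeats 1000000

theorem gray_surj (q : ℕ)
    (Ψ : Rq q →ₗ[ZMod 2] (Finset (Fin q) → ZMod 2))
    (hΨ : ∀ A B : Finset (Fin q), Ψ (uA q A) B = if B ⊆ A then 1 else 0) :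
    ∀ y : Finset (Fin q) → ZMod 2, ∃ x, Ψ x = y := by
  have key : ∀ B : Finset (Fin q), (Pi.single B 1 : Finset (Fin q) → ZMod 2) ∈
      LinearMap.range Ψ := by
    intro B
    induction B using Finset.strongInduction with
    | H B ih =>
      have h : (Pi.single B 1 : Finset (Fin q) → ZMod 2) =
          Ψ (uA q B) - ∑ A ∈ B.ssubsets, Pi.single A 1 := by
        funext D
        rw [Pi.sub_apply, hΨ, Finset.sum_apply]
        simp only [Pi.single_apply, Finset.sum_ite_eq, Finset.mem_ssubsets]
        by_cases h1 : D = B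
        · subst h1
          simp
        · by_cases h2 : D ⊆ B
          · have h3 : D ⊂ B := Finset.ssubset_iff_subset_ne.2 ⟨h2, h1⟩
            simp [h1, h2, h3]
          · have h3 : ¬ D ⊂ B := fun h => h2 h.1
            simp [h1, h2, h3]
      rw [h]
      refine Submodule.sub_mem _ ⟨_, rfl⟩ (Submodule.sum_mem _ ?_)
      intro A hA
      exact ih A (Finset.mem_ssubsets.1 hA)
  intro y
  have hy : y ∈ LinearMap.range Ψ := by
    have h : y = ∑ B, y B • (Pi.single B 1 : Finset (Fin q) → ZMod 2) := by
      funext D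
      simp [Finset.sum_apply, Pi.single_apply]
    rw [h]
    exact Submodule.sum_mem _ fun B _ => Submodule.smul_mem _ _ (key B)
  exact hy

theorem gray_dist (q n : ℕ)
    (Ψ : Rq q →ₗ[ZMod 2] (Finset (Fin q) → ZMod 2)) (x c : Fin n → Rq q) :
    hammingDist (fun p : Fin n × Finset (Fin q) => Ψ (x p.1) p.2)
      (fun p => Ψ (c p.1) p.2) = ∑ i, hammingNorm (Ψ (x i - c i)) := by
  simp only [hammingDist, hammingNorm, map_sub, Pi.sub_apply, Finset.card_filter,
    Fintype.sum_prod_type, sub_ne_zero]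

/-- For every nonempty code `C ⊆ R_q^n` (not necessarily linear), the Lee
covering radius of `C` equals the Hamming covering radius of its coordinatewise Gray image:
`r_Lee(C) = r_Ham(Ψ_Lee(C))`.  Here `d_Lee(x,c) = Σ_i w_Lee(x_i − c_i)` with
`w_Lee = hammingNorm ∘ Ψ`, the Gray map `Ψ` is specified uniquely by `hΨ`, the covering radius
is the max over ambient vectors of the min distance to the code, and max/min are expressed by
`sSup`/`sInf` in `ℕ` (all sets involved are finite and nonempty). -/
theorem lee_covering_radius_eq_gray (q n : ℕ) (hq : 1 ≤ q) [Fintype (Rq q)]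
    (Ψ : Rq q →ₗ[ZMod 2] (Finset (Fin q) → ZMod 2))
    (hΨ : ∀ A B : Finset (Fin q), Ψ (uA q A) B = if B ⊆ A then 1 else 0)
    (C : Set (Fin n → Rq q)) (hC : C.Nonempty) :
    sSup {r : ℕ | ∃ x : Fin n → Rq q,
        r = sInf {d : ℕ | ∃ c ∈ C, d = ∑ i, hammingNorm (Ψ (x i - c i))}} =
    sSup {r : ℕ | ∃ y : Fin n × Finset (Fin q) → ZMod 2,
        r = sInf {d : ℕ | ∃ z ∈ (fun (c : Fin n → Rq q) (p : Fin n × Finset (Fin q)) =>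
            Ψ (c p.1) p.2) '' C, d = hammingDist y z}} := by
  have hs := gray_surj q Ψ hΨ
  have hd : ∀ x : Fin n → Rq q,
      {d : ℕ | ∃ c ∈ C, d = ∑ i, hammingNorm (Ψ (x i - c i))} =
      {d : ℕ | ∃ z ∈ (fun (c : Fin n → Rq q) (p : Fin n × Finset (Fin q)) =>
            Ψ (c p.1) p.2) '' C, d = hammingDist (fun p => Ψ (x p.1) p.2) z} := by
    intro x
    ext d
    simp only [Set.mem_setOf_eq, Set.exists_mem_image, gray_dist]
  congr 1
  ext r
  constructor
  · rintro ⟨x, rfl⟩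
    exact ⟨fun p => Ψ (x p.1) p.2, by rw [hd]⟩
  · rintro ⟨y, rfl⟩
    choose x hx using fun i => hs (fun B => y (i, B))
    have hy : y = fun p => Ψ (x p.1) p.2 := by
      funext p
      rw [hx]
    refine ⟨x, ?_⟩
    rw [hd, ← hy]
end
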